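/- arXiv:1801.03583 — 5 statements merged into one kernel-verified Lean document; each statement's English description precedes it below -/
import Mathlib

section
/- Let X and Y be partially observed random variables with missingness indicators R_X, R_Y and proxies X*, Y*. If X is conditionally independent of the pair (R_X, R_Y) given Y, then for all values x, y with P(Y = y, R_X = 0, R_Y = 0) > 0 one has P(X = x | Y = y) = P(X* = some x | Y* = some y, R_X = 0, R_Y = 0). (Recoverability of P(X|Y) from available cases.) -/
open MeasureTheory

/-- Elementary conditional probability `P(A | B)`. -/
noncomputable def cpr {Ω : Type*} [MeasurableSpace Ω] (P : Measure Ω) (A B : Set Ω) : ENNReal :=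
  P (A ∩ B) / P B

/-- Proxy variable: `X* = some X` when the indicator is `false` (observed, `R = 0`),
and `X* = none` when the indicator is `true` (missing, `R = 1`). -/
def proxy {Ω α : Type*} (X : Ω → α) (R : Ω → Bool) (ω : Ω) : Option α :=
  if R ω = false then some (X ω) else none

/-- **Recoverability of `P(X|Y)` from available cases.**
`X`, `Y` are partially observed random variables with missingness indicators `RX`, `RY`
and proxies `proxy X RX`, `proxy Y RY`.  If `X ⟂ (RX, RY) | Y`, then for all `x, y` with
`P(Y = y, RX = 0, RY = 0) > 0`,
`P(X = x | Y = y) = P(X* = some x | Y* = some y, RX = 0, RY = 0)`. -/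
theorem recoverability_from_available_cases
    {Ω α β : Type*} [MeasurableSpace Ω]
    [Fintype α] [Nonempty α] [Fintype β] [Nonempty β]
    (P : Measure Ω) [IsProbabilityMeasure P]
    (X : Ω → α) (Y : Ω → β) (RX RY : Ω → Bool)
    -- X is conditionally independent of the pair (RX, RY) given Y:
    (hCI : ∀ (x : α) (r : Bool × Bool) (y : β),
      cpr P ({ω | X ω = x} ∩ {ω | (RX ω, RY ω) = r}) {ω | Y ω = y} =
        cpr P {ω | X ω = x} {ω | Y ω = y} *
          cpr P {ω | (RX ω, RY ω) = r} {ω | Y ω = y}) :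
    ∀ (x : α) (y : β), 0 < P {ω | Y ω = y ∧ RX ω = false ∧ RY ω = false} →
      cpr P {ω | X ω = x} {ω | Y ω = y} =
        cpr P {ω | proxy X RX ω = some x}
          {ω | proxy Y RY ω = some y ∧ RX ω = false ∧ RY ω = false} := by
  intro x y hpos
  have h := hCI x (false, false) y
  have hRS : {ω | (RX ω, RY ω) = (false, false)} ∩ {ω | Y ω = y} =
      {ω | Y ω = y ∧ RX ω = false ∧ RY ω = false} := by
    ext ω
    simp only [Set.mem_inter_iff, Set.mem_ofPred_eq, Prod.mk.injEq]
    tauto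
  have hproxyY : {ω | proxy Y RY ω = some y ∧ RX ω = false ∧ RY ω = false} =
      {ω | Y ω = y ∧ RX ω = false ∧ RY ω = false} := by
    ext ω
    by_cases hY : RY ω = false <;> simp [proxy, hY]
  have hproxyX : {ω | proxy X RX ω = some x} ∩ {ω | Y ω = y ∧ RX ω = false ∧ RY ω = false} =
      {ω | X ω = x} ∩ {ω | Y ω = y ∧ RX ω = false ∧ RY ω = false} := by
    ext ω
    by_cases hX : RX ω = false <;> simp [proxy, hX]
  have hle : P {ω | Y ω = y ∧ RX ω = false ∧ RY ω = false} ≤ P {ω | Y ω = y} :=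
    measure_mono fun _ hω => hω.1
  have hS : P {ω | Y ω = y} ≠ 0 := (hpos.trans_le hle).ne'
  have hS' : P {ω | Y ω = y} ≠ ⊤ := measure_ne_top P _
  unfold cpr at h ⊢
  rw [Set.inter_assoc, hRS, ← mul_div_assoc, ENNReal.div_eq_div_iff hS hS' hS hS',
    ENNReal.mul_right_inj hS hS'] at h
  rw [hproxyY, hproxyX, ENNReal.eq_div_iff hpos.ne' (measure_ne_top P _), h, mul_comm]
end

section
/- MAR recovery of the joint distribution (Corollary 2): let V_m be a (vector-valued) partially observed random variable with vector of missingness indicators R and componentwise proxy V_m*, and let V_o be a fully observed random variable. If V_m is conditionally independent of R given V_o (the MAR condition), then for all values v_m, v_o with P(V_o = v_o, R = 0) > 0 one has P(V_m = v_m, V_o = v_o) = P(V_m* = (componentwise some v_m) | V_o = v_o, R = 0) · P(V_o = v_o). -/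
open MeasureTheory

/-- The multiplication rule for `cpr`. -/
theorem cpr_mul_measure {Ω : Type*} [MeasurableSpace Ω] (P : Measure Ω) [IsFiniteMeasure P]
    (A B : Set Ω) : cpr P A B * P B = P (A ∩ B) :=
  ENNReal.div_mul_cancel' (fun h => measure_mono_null Set.inter_subset_right h)
    (fun h => absurd h (measure_ne_top P B))

/-- If `A` and `B` are conditionally independent given `C`, then further conditioning on `B`
does not change the conditional probability of `A` given `C`. -/
theorem cpr_inter_eq_of_cpr_inter_eq_mul {Ω : Type*} [MeasurableSpace Ω] (P : Measure Ω)
    [IsFiniteMeasure P] {A B C : Set Ω} (hBC : P (B ∩ C) ≠ 0)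
    (h : cpr P (A ∩ B) C = cpr P A C * cpr P B C) : cpr P A (B ∩ C) = cpr P A C := by
  have key : P (A ∩ (B ∩ C)) = cpr P A C * P (B ∩ C) := by
    rw [← Set.inter_assoc, ← cpr_mul_measure P (A ∩ B) C, h, mul_assoc, cpr_mul_measure]
  rw [cpr, key, ENNReal.mul_div_cancel_right hBC (measure_ne_top P _)]

theorem proxy_eq_some_iff {Ω α : Type*} (X : Ω → α) (R : Ω → Bool) (ω : Ω) (x : α) :
    proxy X R ω = some x ↔ R ω = false ∧ X ω = x := by
  simp [proxy]

/-- **MAR recovery of the joint distribution (Corollary 2).**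
`Vm` is a vector of partially observed variables with indicators `R` and componentwise
proxies, `Vo` is fully observed.  If `Vm ⟂ R | Vo` (MAR), then for all `v, vo` with
`P(Vo = vo, R = 0) > 0`,
`P(Vm = v, Vo = vo) = P(Vm* = some ∘ v | Vo = vo, R = 0) ⬝ P(Vo = vo)`. -/
theorem mar_joint_recovery
    {Ω γ : Type*} [MeasurableSpace Ω] {k : ℕ} {α : Fin k → Type*}
    [∀ i, Fintype (α i)] [∀ i, Nonempty (α i)] [Fintype γ] [Nonempty γ]
    (P : Measure Ω) [IsProbabilityMeasure P]
    (Vm : ∀ i, Ω → α i) (R : Fin k → Ω → Bool) (Vo : Ω → γ)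
    -- MAR: Vm is conditionally independent of R given Vo:
    (hMAR : ∀ (v : ∀ i, α i) (r : Fin k → Bool) (vo : γ),
      cpr P ({ω | ∀ i, Vm i ω = v i} ∩ {ω | ∀ i, R i ω = r i}) {ω | Vo ω = vo} =
        cpr P {ω | ∀ i, Vm i ω = v i} {ω | Vo ω = vo} *
          cpr P {ω | ∀ i, R i ω = r i} {ω | Vo ω = vo}) :
    ∀ (v : ∀ i, α i) (vo : γ), 0 < P {ω | Vo ω = vo ∧ ∀ i, R i ω = false} →
      P {ω | (∀ i, Vm i ω = v i) ∧ Vo ω = vo} =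
        cpr P {ω | ∀ i, proxy (Vm i) (R i) ω = some (v i)}
            {ω | Vo ω = vo ∧ ∀ i, R i ω = false} * P {ω | Vo ω = vo} := by
  intro v vo hpos
  set A : Set Ω := {ω | ∀ i, Vm i ω = v i}
  set B : Set Ω := {ω | ∀ i, R i ω = false}
  set C : Set Ω := {ω | Vo ω = vo}
  have hBC : {ω | Vo ω = vo ∧ ∀ i, R i ω = false} = B ∩ C := Set.inter_comm C B
  have hproxy : {ω | ∀ i, proxy (Vm i) (R i) ω = some (v i)} ∩ (B ∩ C) = A ∩ (B ∩ C) := by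
    ext ω
    simp only [proxy_eq_some_iff, forall_and, Set.mem_inter_iff, Set.mem_ofPred_eq, A, B]
    tauto
  rw [hBC] at hpos ⊢
  rw [cpr, hproxy, ← cpr,
    cpr_inter_eq_of_cpr_inter_eq_mul P hpos.ne' (hMAR v (fun _ => false) vo), cpr_mul_measure]
  rfl
end

section
/- Non-recoverability under self-masking (instance of Theorem 3, first condition): there exist two probability measures P₁ and P₂ on Bool × Bool (coordinates interpreted as a variable X and its missingness indicator R_X) such that the pushforwards of P₁ and P₂ under the masking map (x, r) ↦ (if r = 0 then some x else none, r) from Bool × Bool to Option Bool × Bool are equal and assign positive probability to every point (some x, 0) and to the point (none, 1), yet the marginal distributions of the first coordinate X under P₁ and P₂ are different. Consequently no procedure can compute P(X) consistently from the observed-data distribution when X is a direct cause of its own missingness. -/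
open MeasureTheory

/-- Discrete σ-algebra on `Option α`. -/
instance {α : Type*} : MeasurableSpace (Option α) := ⊤

/-- The masking map `(x, r) ↦ (if r = 0 then some x else none, r)`; `r = false` means
observed (`R = 0`), `r = true` means missing (`R = 1`). -/
def mask {α : Type*} (p : α × Bool) : Option α × Bool :=
  (if p.2 = false then some p.1 else none, p.2)

/-- The law on `Bool × Bool` with mass `1/3` at `(true, 0)`, `(false, 0)` and `(b, 1)`. -/
noncomputable def selfMaskingLaw (b : Bool) : Measure (Bool × Bool) :=
  (3 : ENNReal)⁻¹ • (Measure.dirac (true, false) + Measure.dirac (false, false) +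
    Measure.dirac (b, true))

theorem isProbabilityMeasure_selfMaskingLaw (b : Bool) :
    IsProbabilityMeasure (selfMaskingLaw b) := by
  constructor
  have h : (1 + 1 + 1 : ENNReal) = 3 := by norm_num
  simp only [selfMaskingLaw, Measure.smul_apply, Measure.add_apply, measure_univ, smul_eq_mul, h]
  exact ENNReal.inv_mul_cancel (by norm_num) (by norm_num)

theorem map_selfMaskingLaw {β : Type*} [MeasurableSpace β] (f : Bool × Bool → β) (b : Bool) :
    (selfMaskingLaw b).map f = (3 : ENNReal)⁻¹ • (Measure.dirac (f (true, false)) +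
      Measure.dirac (f (false, false)) + Measure.dirac (f (b, true))) := by
  have hf : Measurable f := measurable_of_countable f
  simp only [selfMaskingLaw, Measure.map_smul, Measure.map_add _ _ hf, Measure.map_dirac' hf]

/-- **Non-recoverability under self-masking (instance of Theorem 3, first condition).**
There exist two probability measures on `Bool × Bool` (a variable `X` and its own
missingness indicator `R_X`) whose masked (observed-data) distributions coincide and put
positive mass on every point `(some x, 0)` and on `(none, 1)`, while their marginal
distributions of `X` differ.  Hence `P(X)` is not recoverable when `X` causes its own
missingness. -/
theorem self_masking_non_recoverable :
    ∃ (P₁ P₂ : Measure (Bool × Bool)),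
      IsProbabilityMeasure P₁ ∧ IsProbabilityMeasure P₂ ∧
      P₁.map mask = P₂.map mask ∧
      (∀ x : Bool, 0 < P₁.map mask {((some x : Option Bool), false)}) ∧
      0 < P₁.map mask {((none : Option Bool), true)} ∧
      P₁.map Prod.fst ≠ P₂.map Prod.fst := by
  have : DiscreteMeasurableSpace (Option Bool) := ⟨fun _ => trivial⟩
  refine ⟨selfMaskingLaw true, selfMaskingLaw false, isProbabilityMeasure_selfMaskingLaw _,
    isProbabilityMeasure_selfMaskingLaw _, ?_, ?_, ?_, ?_⟩
  · simp [map_selfMaskingLaw, mask]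
  · intro x
    cases x <;> simp [map_selfMaskingLaw, mask]
  · simp [map_selfMaskingLaw, mask]
  · intro h
    have h' := congrArg (fun μ => μ {true}) h
    simp [map_selfMaskingLaw] at h'
end

section
/- Untestability of X ⟂ R_X (special case of Theorem 4, Example 9): let X be a nonempty finite type. For every probability measure Q on Option X × Bool (coordinates X*, R_X) such that Q-almost surely X* = none if and only if R_X = 1, and such that Q assigns positive probability to the point (none, 1) and to every point (some x, 0), there exists a probability measure P on X × Bool under which the first coordinate X is independent of the second coordinate R_X, and whose pushforward under the masking map (x, r) ↦ (if r = 0 then some x else none, r) equals Q. Hence the independence claim X ⟂ R_X cannot be refuted by any observed-data distribution. -/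
open MeasureTheory

/-- **Untestability of `X ⟂ R_X` (special case of Theorem 4, Example 9).**
For every observed-data distribution `Q` on `X* × R_X` that is consistent with the
masking (a.s. `X* = none ↔ R_X = 1`) and puts positive mass on `(none, 1)` and on every
point `(some x, 0)`, there is an underlying distribution `P` on `X × R_X` making `X`
independent of `R_X` whose masked distribution is exactly `Q`.  Hence `X ⟂ R_X` cannot
be refuted by any observed-data distribution. -/
theorem indep_X_RX_untestable
    {X : Type*} [Fintype X] [Nonempty X]
    [MeasurableSpace X] [MeasurableSingletonClass X]
    (Q : Measure (Option X × Bool)) [IsProbabilityMeasure Q]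
    -- Q-a.s., X* = none iff R_X = 1:
    (hae : Q {q | ¬ (q.1 = none ↔ q.2 = true)} = 0)
    -- positive probability on (none, 1) and on every (some x, 0):
    (hnone : 0 < Q {((none : Option X), true)})
    (hsome : ∀ x : X, 0 < Q {((some x : Option X), false)}) :
    ∃ P : Measure (X × Bool), IsProbabilityMeasure P ∧
      -- the first coordinate X is independent of the second coordinate R_X under P:
      (∀ (x : X) (r : Bool),
        P {p | p.1 = x ∧ p.2 = r} = P {p | p.1 = x} * P {p | p.2 = r}) ∧
      P.map mask = Q := by
  have hQ : ∀ᵐ q ∂Q, (q.1 = none ↔ q.2 = true) := hae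
  have hemb : MeasurableEmbedding (fun x : X => ((some x : Option X), false)) :=
    { injective := fun a b h => by simpa using h
      measurable := .of_discrete
      measurableSet_image' := fun _ _ => (Set.toFinite _).measurableSet }
  set ν : Measure Bool := Q.map Prod.snd with hν
  have hνp : IsProbabilityMeasure ν := Measure.isProbabilityMeasure_map measurable_snd.aemeasurable
  set κ : Measure X := Q.comap (fun x : X => ((some x : Option X), false)) with hκ
  have hνr (r : Bool) : ν {r} = Q {q | q.2 = r} :=
    Measure.map_apply measurable_snd (measurableSet_singleton r)
  have hκx (x : X) : κ {x} = Q {((some x : Option X), false)} := by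
    rw [hκ, hemb.comap_apply, Set.image_singleton]
  have hκu : κ Set.univ = ν {false} := by
    rw [hκ, hemb.comap_apply, hνr]
    refine measure_congr (Filter.eventuallyEq_set.2 ?_)
    filter_upwards [hQ] with q hq
    obtain ⟨_ | x, _ | _⟩ := q <;> simp at hq ⊢
  have hν0 : ν {false} ≠ 0 := by
    obtain ⟨x⟩ := ‹Nonempty X›
    rw [hνr]
    exact ((hsome x).trans_le (measure_mono (by simp))).ne'
  have hνt : ν {false} ≠ ⊤ := measure_ne_top _ _
  have hμp : IsProbabilityMeasure ((ν {false})⁻¹ • κ) :=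
    ⟨by rw [Measure.smul_apply, hκu, smul_eq_mul, ENNReal.inv_mul_cancel hν0 hνt]⟩
  set μ := (ν {false})⁻¹ • κ with hμ
  refine ⟨μ.prod ν, inferInstance, fun x r => ?_, ?_⟩
  · have h1 : {p : X × Bool | p.1 = x ∧ p.2 = r} = {x} ×ˢ {r} := by ext; simp [Prod.ext_iff]
    have h2 : {p : X × Bool | p.1 = x} = {x} ×ˢ Set.univ := by ext; simp
    have h3 : {p : X × Bool | p.2 = r} = Set.univ ×ˢ {r} := by ext; simp
    rw [h1, h2, h3]
    simp only [Measure.prod_prod, measure_univ, mul_one, one_mul]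
  · refine Measure.ext_of_singleton fun q => ?_
    rw [Measure.map_apply (.of_discrete) (measurableSet_singleton q)]
    obtain ⟨_ | x, _ | _⟩ := q
    · have h : mask ⁻¹' {((none : Option X), false)} = ∅ := by
        ext ⟨x, _ | _⟩ <;> simp [mask]
      rw [h, measure_empty]
      exact (measure_mono_null (by simp) hae).symm
    · have h : mask ⁻¹' {((none : Option X), true)} = Set.univ ×ˢ {true} := by
        ext ⟨x, _ | _⟩ <;> simp [mask]
      rw [h, Measure.prod_prod, measure_univ, one_mul, hνr]
      refine measure_congr (Filter.eventuallyEq_set.2 ?_)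
      filter_upwards [hQ] with q hq
      obtain ⟨_ | x, _ | _⟩ := q <;> simp at hq ⊢
    · have h : mask ⁻¹' {((some x : Option X), false)} = {x} ×ˢ {false} := by
        ext ⟨y, _ | _⟩ <;> simp [mask]
      rw [h, Measure.prod_prod, hμ, Measure.smul_apply, hκx, smul_eq_mul, mul_right_comm,
        ENNReal.inv_mul_cancel hν0 hνt, one_mul]
    · have h : mask ⁻¹' {((some x : Option X), true)} = ∅ := by
        ext ⟨y, _ | _⟩ <;> simp [mask]
      rw [h, measure_empty]
      exact (measure_mono_null (by simp) hae).symm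
end

section
/- Testable implication of syntactic rule (3) of Theorem 5: let Z be a partially observed random variable with missingness indicator R_Z and proxy Z*, and let R_X, R_Y be {0,1}-valued missingness indicators of two other partially observed variables. If R_X is conditionally independent of R_Y given (Z, R_Z), then for all values z and r, s ∈ {0,1} with P(R_Y = s, Z* = some z, R_Z = 0) > 0 one has P(R_X = r | Z* = some z, R_Z = 0) = P(R_X = r | R_Y = s, Z* = some z, R_Z = 0); that is, the independence claim implies an identity expressed entirely in terms of the observed-data distribution. -/
open MeasureTheory

/-- The conditional product rule for `A` and `C` given `B` yields `P(A | B) = P(A | C ∩ B)`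
whenever `C ∩ B` has positive measure. -/
theorem cpr_eq_cpr_inter_of_cpr_inter_eq_mul {Ω : Type*} [MeasurableSpace Ω] (P : Measure Ω)
    [IsFiniteMeasure P] {A B C : Set Ω} (h : cpr P (A ∩ C) B = cpr P A B * cpr P C B)
    (hCB : P (C ∩ B) ≠ 0) : cpr P A B = cpr P A (C ∩ B) := by
  have hB : P B ≠ 0 := fun h0 => hCB (measure_mono_null Set.inter_subset_right h0)
  have hBt : P B ≠ ⊤ := measure_ne_top P B
  unfold cpr at h ⊢
  rw [ENNReal.eq_div_iff hCB (measure_ne_top P _), ← Set.inter_assoc,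
    ← ENNReal.mul_div_cancel hB hBt (b := P (A ∩ C ∩ B)), h,
    mul_left_comm, ENNReal.mul_div_cancel hB hBt, mul_comm]

/-- The proxy is observed with value `x` exactly when `X = x` and `X` is not missing. -/
theorem proxy_eq_some_and_iff {Ω α : Type*} (X : Ω → α) (R : Ω → Bool) (ω : Ω) (x : α) :
    (proxy X R ω = some x ∧ R ω = false) ↔ (X ω = x ∧ R ω = false) := by
  unfold proxy
  grind

/-- **Testable implication of syntactic rule (3) of Theorem 5.**
`Z` is partially observed with indicator `RZ` and proxy `Z*`; `RX`, `RY` are the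
missingness indicators of two other partially observed variables.  If
`R_X ⟂ R_Y | (Z, R_Z)`, then for all `z` and `r, s` with
`P(R_Y = s, Z* = some z, R_Z = 0) > 0`,
`P(R_X = r | Z* = some z, R_Z = 0) = P(R_X = r | R_Y = s, Z* = some z, R_Z = 0)`,
an identity expressed entirely in terms of the observed-data distribution. -/
theorem testable_rule_three
    {Ω γ : Type*} [MeasurableSpace Ω] [Fintype γ] [Nonempty γ]
    (P : Measure Ω) [IsProbabilityMeasure P]
    (Z : Ω → γ) (RX RY RZ : Ω → Bool)
    -- RX is conditionally independent of RY given (Z, RZ):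
    (hCI : ∀ (rx ry : Bool) (z : γ) (rz : Bool),
      cpr P ({ω | RX ω = rx} ∩ {ω | RY ω = ry}) {ω | Z ω = z ∧ RZ ω = rz} =
        cpr P {ω | RX ω = rx} {ω | Z ω = z ∧ RZ ω = rz} *
          cpr P {ω | RY ω = ry} {ω | Z ω = z ∧ RZ ω = rz}) :
    ∀ (z : γ) (r s : Bool),
      0 < P {ω | RY ω = s ∧ proxy Z RZ ω = some z ∧ RZ ω = false} →
      cpr P {ω | RX ω = r} {ω | proxy Z RZ ω = some z ∧ RZ ω = false} =
        cpr P {ω | RX ω = r} {ω | RY ω = s ∧ proxy Z RZ ω = some z ∧ RZ ω = false} := by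
  intro z r s hpos
  simp only [proxy_eq_some_and_iff] at hpos ⊢
  exact cpr_eq_cpr_inter_of_cpr_inter_eq_mul P (hCI r s z false) hpos.ne'
end
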